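/- For every n ≥ 0 and every 0 ≤ k ≤ n−1, letting π = λ_k ⊕ (1 ⊖ ρ_{n−k−1}), the map P restricts to a bijection between Av(231, π) and Av(132, P(π)): for every 231-avoiding σ, σ contains π if and only if P(σ) contains P(π). -/

import Mathlib

/-- Stack sorting with fuel (fuel = length always suffices). -/
def stackSortAux : ℕ → List ℕ → List ℕ
  | 0, _ => []
  | _ + 1, [] => []
  | fuel + 1, x :: xs =>
    let l := x :: xs
    let m := l.foldr max 0
    stackSortAux fuel (l.takeWhile (· ≠ m)) ++
      stackSortAux fuel ((l.dropWhile (· ≠ m)).tail) ++ [m]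

/-- The stack sorting operator `S`: `S(ε) = ε` and `S(α n β) = S(α) S(β) n`
where `n` is the maximum element. -/
def stackSort (l : List ℕ) : List ℕ := stackSortAux l.length l

/-- `σ` avoids the pattern 231. -/
def Avoids231 (σ : List ℕ) : Prop :=
  ¬ ∃ i j k, i < j ∧ j < k ∧ k < σ.length ∧
      σ.getD k 0 < σ.getD i 0 ∧ σ.getD i 0 < σ.getD j 0

/-- `σ` avoids the pattern 132. -/
def Avoids132 (σ : List ℕ) : Prop :=
  ¬ ∃ i j k, i < j ∧ j < k ∧ k < σ.length ∧
      σ.getD i 0 < σ.getD k 0 ∧ σ.getD k 0 < σ.getD j 0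

/-- Binary trees with natural number labels. -/
inductive BTree where
  | leaf : BTree
  | node : BTree → ℕ → BTree → BTree

def BTree.inorder : BTree → List ℕ
  | .leaf => []
  | .node l n r => l.inorder ++ [n] ++ r.inorder

def BTree.postorder : BTree → List ℕ
  | .leaf => []
  | .node l n r => l.postorder ++ r.postorder ++ [n]

/-- A tree is decreasing when labels strictly decrease from root to leaves. -/
def BTree.Decreasing : BTree → Prop
  | .leaf => True
  | .node l n r =>
      l.Decreasing ∧ r.Decreasing ∧
      (∀ x ∈ l.inorder, x < n) ∧ (∀ x ∈ r.inorder, x < n)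

/-- The underlying unlabeled shape of a tree (labels replaced by `0`). -/
def BTree.shape : BTree → BTree
  | .leaf => .leaf
  | .node l _ r => .node l.shape 0 r.shape

def BTree.map (f : ℕ → ℕ) : BTree → BTree
  | .leaf => .leaf
  | .node l n r => .node (l.map f) (f n) (r.map f)

/-- Labels on the rightmost branch from the root. -/
def BTree.rightBranch : BTree → List ℕ
  | .leaf => []
  | .node _ n r => n :: r.rightBranch

/-- Labels on the leftmost branch from the root. -/
def BTree.leftBranch : BTree → List ℕ
  | .leaf => []
  | .node l n _ => n :: l.leftBranch

def TinAux : ℕ → List ℕ → BTree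
  | 0, _ => .leaf
  | _ + 1, [] => .leaf
  | fuel + 1, x :: xs =>
    let l := x :: xs
    let m := l.foldr max 0
    .node (TinAux fuel (l.takeWhile (· ≠ m))) m
          (TinAux fuel ((l.dropWhile (· ≠ m)).tail))

/-- The decreasing binary tree whose in-order reading is `l`. -/
def Tin (l : List ℕ) : BTree := TinAux l.length l

def PpermAux : ℕ → List ℕ → List ℕ
  | 0, _ => []
  | _ + 1, [] => []
  | fuel + 1, x :: xs =>
    let l := x :: xs
    let m := l.foldr max 0
    let α := l.takeWhile (· ≠ m)
    let β := (l.dropWhile (· ≠ m)).tail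
    (PpermAux fuel α).map (· + β.length) ++ [m] ++
      PpermAux fuel (β.map (· - α.length))

/-- The bijection `P` from 231-avoiding to 132-avoiding permutations,
`P(ε) = ε` and `P(α ⊕ (1 ⊖ β)) = (P(α) ⊕ 1) ⊖ P(β)`. -/
def Pperm (l : List ℕ) : List ℕ := PpermAux l.length l

/-- Direct sum of permutations: `α ⊕ β`. -/
def osum (α β : List ℕ) : List ℕ := α ++ β.map (· + α.length)

/-- Skew sum of permutations: `α ⊖ β`. -/
def ossum (α β : List ℕ) : List ℕ := α.map (· + β.length) ++ β

def lrP : ℕ → List ℕ × List ℕ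
  | 0 => ([], [])
  | m + 1 => (ossum [1] (lrP m).2, osum (lrP m).1 [1])

/-- `λ_n`: `λ_{m+1} = 1 ⊖ ρ_m`. -/
def lamP (n : ℕ) : List ℕ := (lrP n).1

/-- `ρ_n`: `ρ_{m+1} = λ_m ⊕ 1`. -/
def rhoP (n : ℕ) : List ℕ := (lrP n).2

/-- `s` and `p` are order isomorphic lists. -/
def OrderIsoList (s p : List ℕ) : Prop :=
  s.length = p.length ∧
  ∀ i j, i < s.length → j < s.length →
    (s.getD i 0 < s.getD j 0 ↔ p.getD i 0 < p.getD j 0)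

/-- `σ` contains the pattern `π`. -/
def Contains (σ π : List ℕ) : Prop :=
  ∃ s : List ℕ, s.Sublist σ ∧ OrderIsoList s π

/-- The up-down word of a permutation (`true` = ascent `u`, `false` = descent `d`). -/
def updown (l : List ℕ) : List Bool :=
  (l.zip l.tail).map (fun p => decide (p.1 < p.2))

/-- No value larger than `max x y` occurs (strictly) between `x` and `y` in `l`. -/
def NoLargerBetween (l : List ℕ) (x y : ℕ) : Prop :=
  ∀ i j k, i < j → j < k → k < l.length →
    ((l.getD i 0 = x ∧ l.getD k 0 = y) ∨ (l.getD i 0 = y ∧ l.getD k 0 = x)) →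
    l.getD j 0 ≤ max x y

/-- The basic operators: stack sorting `S` and reversal `R`. -/
inductive SOp where
  | s : SOp
  | r : SOp

def applyOp : SOp → List ℕ → List ℕ
  | .s => stackSort
  | .r => List.reverse

/-- A composition of operators from `{S, R}`. -/
def applyOps (ops : List SOp) : List ℕ → List ℕ :=
  ops.foldr (fun op f => applyOp op ∘ f) id

/-- `i` is the position of a left-to-right maximum of `l`. -/
def LRmaxPos (l : List ℕ) (i : ℕ) : Prop :=
  i < l.length ∧ ∀ j, j < i → l.getD j 0 < l.getD i 0

/-- `i` is the position of a right-to-left maximum of `l`. -/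
def RLmaxPos (l : List ℕ) (i : ℕ) : Prop :=
  i < l.length ∧ ∀ j, i < j → j < l.length → l.getD j 0 < l.getD i 0

/-- The reverse Zeilberger statistic: the largest `k` such that
`(n-k+1) … (n-1) n` is a subword of `l`, where `n = l.length`. -/
noncomputable def Rzeil (l : List ℕ) : ℕ :=
  sSup {k | (List.range' (l.length - k + 1) k).Sublist l}
theorem oi_length {s p : List ℕ} (h : OrderIsoList s p) : s.length = p.length := h.1

theorem oi_map_right (s p : List ℕ) (c : ℕ) :
    OrderIsoList s (p.map (· + c)) ↔ OrderIsoList s p := by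
  unfold OrderIsoList
  rw [List.length_map]
  refine and_congr_right fun h => ?_
  refine forall_congr' fun i => forall_congr' fun j => forall_congr' fun hi => forall_congr' fun hj => ?_
  have hi' : i < p.length := h ▸ hi
  have hj' : j < p.length := h ▸ hj
  simp [List.getD_eq_getElem?_getD, hi', hj']

theorem oi_map_left (s p : List ℕ) (c : ℕ) :
    OrderIsoList (s.map (· + c)) p ↔ OrderIsoList s p := by
  unfold OrderIsoList
  rw [List.length_map]
  refine and_congr_right fun h => ?_
  refine forall_congr' fun i => forall_congr' fun j => forall_congr' fun hi => forall_congr' fun hj => ?_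
  simp [List.getD_eq_getElem?_getD, hi, hj]

theorem oi_nil (s : List ℕ) : OrderIsoList s [] ↔ s = [] := by
  constructor
  · intro h; exact List.length_eq_zero_iff.1 h.1
  · rintro rfl; exact ⟨rfl, by simp⟩

theorem oi_single (s : List ℕ) (c : ℕ) : OrderIsoList s [c] ↔ ∃ b, s = [b] := by
  constructor
  · intro h; exact List.length_eq_one_iff.1 h.1
  · rintro ⟨b, rfl⟩
    refine ⟨rfl, ?_⟩
    intro i j hi hj
    simp at hi hj
    subst hi hj
    simp

theorem getD_app_left (s t : List ℕ) (i : ℕ) (h : i < s.length) :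
    (s ++ t).getD i 0 = s.getD i 0 := by
  simp [List.getD_eq_getElem?_getD, List.getElem?_append_left h]

theorem getD_app_right (s t : List ℕ) (i : ℕ) :
    (s ++ t).getD (s.length + i) 0 = t.getD i 0 := by
  rw [List.getD_eq_getElem?_getD, List.getElem?_append_right (by omega)]
  simp [List.getD_eq_getElem?_getD]

theorem oi_append (s t p q : List ℕ) (hs : s.length = p.length) :
    OrderIsoList (s ++ t) (p ++ q) ↔ OrderIsoList s p ∧ OrderIsoList t q ∧
      ∀ i j, i < s.length → j < t.length →
        ((s.getD i 0 < t.getD j 0 ↔ p.getD i 0 < q.getD j 0) ∧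
         (t.getD j 0 < s.getD i 0 ↔ q.getD j 0 < p.getD i 0)) := by
  constructor
  · rintro ⟨hl, h⟩
    simp only [List.length_append] at hl h
    refine ⟨⟨hs, ?_⟩, ⟨by omega, ?_⟩, ?_⟩
    · intro i j hi hj
      have := h i j (by omega) (by omega)
      rwa [getD_app_left _ _ _ hi, getD_app_left _ _ _ hj, getD_app_left _ _ _ (hs ▸ hi),
        getD_app_left _ _ _ (hs ▸ hj)] at this
    · intro i j hi hj
      have := h (s.length + i) (s.length + j) (by omega) (by omega)
      rw [getD_app_right, getD_app_right, hs, getD_app_right, getD_app_right] at this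
      exact this
    · intro i j hi hj
      have h1 := h i (s.length + j) (by omega) (by omega)
      have h2 := h (s.length + j) i (by omega) (by omega)
      rw [getD_app_right, getD_app_left _ _ _ hi, hs, getD_app_right,
        getD_app_left _ _ _ (hs ▸ hi)] at h1 h2
      exact ⟨h1, h2⟩
  · rintro ⟨⟨h1, h1'⟩, ⟨h2, h2'⟩, h3⟩
    refine ⟨by simp [h1, h2], ?_⟩
    intro i j hi hj
    simp only [List.length_append] at hi hj
    rcases lt_or_ge i s.length with hi' | hi' <;> rcases lt_or_ge j s.length with hj' | hj'
    · rw [getD_app_left _ _ _ hi', getD_app_left _ _ _ hj', getD_app_left _ _ _ (hs ▸ hi'),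
        getD_app_left _ _ _ (hs ▸ hj')]
      exact h1' i j hi' hj'
    · obtain ⟨j, rfl⟩ := Nat.exists_eq_add_of_le hj'
      rw [getD_app_right, getD_app_left _ _ _ hi', hs, getD_app_right,
        getD_app_left _ _ _ (hs ▸ hi')]
      exact (h3 i j hi' (by omega)).1
    · obtain ⟨i, rfl⟩ := Nat.exists_eq_add_of_le hi'
      rw [getD_app_right, getD_app_left _ _ _ hj', hs, getD_app_right,
        getD_app_left _ _ _ (hs ▸ hj')]
      exact (h3 j i hj' (by omega)).2
    · obtain ⟨i, rfl⟩ := Nat.exists_eq_add_of_le hi'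
      obtain ⟨j, rfl⟩ := Nat.exists_eq_add_of_le hj'
      rw [getD_app_right, getD_app_right, hs, getD_app_right, getD_app_right]
      exact h2' i j (by omega) (by omega)

theorem getD_mem' (l : List ℕ) (i : ℕ) (h : i < l.length) : l.getD i 0 ∈ l := by
  rw [List.getD_eq_getElem _ _ h]; exact List.getElem_mem h

theorem mem_getD' (l : List ℕ) (x : ℕ) (h : x ∈ l) : ∃ i, i < l.length ∧ l.getD i 0 = x := by
  obtain ⟨i, hi, rfl⟩ := List.mem_iff_getElem.1 h
  exact ⟨i, hi, List.getD_eq_getElem _ _ hi⟩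

theorem oi_split {s p q : List ℕ} (h : OrderIsoList s (p ++ q)) :
    ∃ s1 s2, s = s1 ++ s2 ∧ s1.length = p.length := by
  refine ⟨s.take p.length, s.drop p.length, (List.take_append_drop _ _).symm, ?_⟩
  have := h.1
  simp at this ⊢
  omega

theorem oi_up {p q : List ℕ} (hpq : ∀ x ∈ p, ∀ y ∈ q, x < y) (s : List ℕ) :
    OrderIsoList s (p ++ q) ↔ ∃ s1 s2, s = s1 ++ s2 ∧ OrderIsoList s1 p ∧ OrderIsoList s2 q ∧
      ∀ x ∈ s1, ∀ y ∈ s2, x < y := by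
  constructor
  · intro h
    obtain ⟨s1, s2, rfl, hl⟩ := oi_split h
    obtain ⟨h1, h2, h3⟩ := (oi_append _ _ _ _ hl).1 h
    refine ⟨s1, s2, rfl, h1, h2, ?_⟩
    intro x hx y hy
    obtain ⟨i, hi, rfl⟩ := mem_getD' _ _ hx
    obtain ⟨j, hj, rfl⟩ := mem_getD' _ _ hy
    exact (h3 i j hi hj).1.2 (hpq _ (getD_mem' _ _ (hl ▸ hi)) _ (getD_mem' _ _ (h2.1 ▸ hj)))
  · rintro ⟨s1, s2, rfl, h1, h2, h3⟩
    refine (oi_append _ _ _ _ h1.1).2 ⟨h1, h2, ?_⟩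
    intro i j hi hj
    have a := h3 _ (getD_mem' _ _ hi) _ (getD_mem' _ _ hj)
    have b := hpq _ (getD_mem' _ _ (h1.1 ▸ hi)) _ (getD_mem' _ _ (h2.1 ▸ hj))
    constructor <;> constructor <;> intro <;> omega

theorem oi_down {p q : List ℕ} (hpq : ∀ x ∈ p, ∀ y ∈ q, y < x) (s : List ℕ) :
    OrderIsoList s (p ++ q) ↔ ∃ s1 s2, s = s1 ++ s2 ∧ OrderIsoList s1 p ∧ OrderIsoList s2 q ∧
      ∀ x ∈ s1, ∀ y ∈ s2, y < x := by
  constructor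
  · intro h
    obtain ⟨s1, s2, rfl, hl⟩ := oi_split h
    obtain ⟨h1, h2, h3⟩ := (oi_append _ _ _ _ hl).1 h
    refine ⟨s1, s2, rfl, h1, h2, ?_⟩
    intro x hx y hy
    obtain ⟨i, hi, rfl⟩ := mem_getD' _ _ hx
    obtain ⟨j, hj, rfl⟩ := mem_getD' _ _ hy
    exact (h3 i j hi hj).2.2 (hpq _ (getD_mem' _ _ (hl ▸ hi)) _ (getD_mem' _ _ (h2.1 ▸ hj)))
  · rintro ⟨s1, s2, rfl, h1, h2, h3⟩
    refine (oi_append _ _ _ _ h1.1).2 ⟨h1, h2, ?_⟩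
    intro i j hi hj
    have a := h3 _ (getD_mem' _ _ hi) _ (getD_mem' _ _ hj)
    have b := hpq _ (getD_mem' _ _ (h1.1 ▸ hi)) _ (getD_mem' _ _ (h2.1 ▸ hj))
    constructor <;> constructor <;> intro <;> omega

/-- All entries lie between 1 and the length. -/
def Bdd (l : List ℕ) : Prop := ∀ x ∈ l, 1 ≤ x ∧ x ≤ l.length

theorem bdd_osum {p q : List ℕ} (hp : Bdd p) (hq : Bdd q) : Bdd (osum p q) := by
  intro x hx
  simp only [osum, List.mem_append, List.mem_map, List.length_append, List.length_map] at hx ⊢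
  rcases hx with hx | ⟨y, hy, rfl⟩
  · have := hp x hx; omega
  · have := hq y hy; omega

theorem bdd_ossum {p q : List ℕ} (hp : Bdd p) (hq : Bdd q) : Bdd (ossum p q) := by
  intro x hx
  simp only [ossum, List.mem_append, List.mem_map, List.length_append, List.length_map] at hx ⊢
  rcases hx with ⟨y, hy, rfl⟩ | hx
  · have := hp y hy; omega
  · have := hq x hx; omega

theorem bdd_one : Bdd [1] := by intro x hx; simp at hx; subst hx; simp

theorem bdd_lr (m : ℕ) : Bdd (lamP m) ∧ Bdd (rhoP m) := by
  induction m with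
  | zero => constructor <;> intro x hx <;> simp [lamP, rhoP, lrP] at hx
  | succ m ih => exact ⟨bdd_ossum bdd_one ih.2, bdd_osum ih.1 bdd_one⟩

theorem oi_osum {p q : List ℕ} (hp : Bdd p) (hq : Bdd q) (s : List ℕ) :
    OrderIsoList s (osum p q) ↔ ∃ s1 s2, s = s1 ++ s2 ∧ OrderIsoList s1 p ∧ OrderIsoList s2 q ∧
      ∀ x ∈ s1, ∀ y ∈ s2, x < y := by
  unfold osum
  rw [oi_up]
  · simp only [oi_map_right]
  · intro x hx y hy
    obtain ⟨z, hz, rfl⟩ := List.mem_map.1 hy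
    have := hp x hx; have := hq z hz; omega

theorem oi_ossum {p q : List ℕ} (hp : Bdd p) (hq : Bdd q) (s : List ℕ) :
    OrderIsoList s (ossum p q) ↔ ∃ s1 s2, s = s1 ++ s2 ∧ OrderIsoList s1 p ∧ OrderIsoList s2 q ∧
      ∀ x ∈ s1, ∀ y ∈ s2, y < x := by
  unfold ossum
  rw [oi_down]
  · simp only [oi_map_right]
  · intro x hx y hy
    obtain ⟨z, hz, rfl⟩ := List.mem_map.1 hx
    have := hp z hz; have := hq y hy; omega

def Lam (m : ℕ) (s : List ℕ) : Prop := OrderIsoList s (lamP m)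
def Rho (m : ℕ) (s : List ℕ) : Prop := OrderIsoList s (rhoP m)

theorem lam_zero (s : List ℕ) : Lam 0 s ↔ s = [] := oi_nil s
theorem rho_zero (s : List ℕ) : Rho 0 s ↔ s = [] := oi_nil s

theorem lam_succ (m : ℕ) (s : List ℕ) :
    Lam (m + 1) s ↔ ∃ a s', s = a :: s' ∧ Rho m s' ∧ ∀ x ∈ s', x < a := by
  have : Lam (m + 1) s ↔ OrderIsoList s (ossum [1] (rhoP m)) := Iff.rfl
  rw [this, oi_ossum bdd_one (bdd_lr m).2]
  constructor
  · rintro ⟨s1, s2, rfl, h1, h2, h3⟩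
    obtain ⟨b, rfl⟩ := (oi_single _ _).1 h1
    exact ⟨b, s2, rfl, h2, fun x hx => h3 b (by simp) x hx⟩
  · rintro ⟨a, s', rfl, h1, h2⟩
    refine ⟨[a], s', rfl, (oi_single _ _).2 ⟨a, rfl⟩, h1, ?_⟩
    simpa using h2

theorem rho_succ (m : ℕ) (s : List ℕ) :
    Rho (m + 1) s ↔ ∃ s' a, s = s' ++ [a] ∧ Lam m s' ∧ ∀ x ∈ s', x < a := by
  have : Rho (m + 1) s ↔ OrderIsoList s (osum (lamP m) [1]) := Iff.rfl
  rw [this, oi_osum (bdd_lr m).1 bdd_one]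
  constructor
  · rintro ⟨s1, s2, rfl, h1, h2, h3⟩
    obtain ⟨b, rfl⟩ := (oi_single _ _).1 h2
    exact ⟨s1, b, rfl, h1, fun x hx => h3 x hx b (by simp)⟩
  · rintro ⟨s', a, rfl, h1, h2⟩
    refine ⟨s', [a], rfl, h1, (oi_single _ _).2 ⟨a, rfl⟩, ?_⟩
    simpa using h2

/-- `l` has a sublist satisfying `R`. -/
def Has (R : List ℕ → Prop) (l : List ℕ) : Prop := ∃ s : List ℕ, s.Sublist l ∧ R s

theorem contains_map (l p : List ℕ) (c : ℕ) : Contains (l.map (· + c)) p ↔ Contains l p := by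
  constructor
  · rintro ⟨s, hs, h⟩
    obtain ⟨s', hs', rfl⟩ := List.sublist_map_iff.1 hs
    exact ⟨s', hs', (oi_map_left _ _ _).1 h⟩
  · rintro ⟨s, hs, h⟩
    exact ⟨s.map (· + c), hs.map _, (oi_map_left _ _ _).2 h⟩

theorem has_mono {R : List ℕ → Prop} {l l' : List ℕ} (h : l.Sublist l') : Has R l → Has R l' :=
  fun ⟨s, hs, h'⟩ => ⟨s, hs.trans h, h'⟩

theorem Pperm_sub_left (X Y : List ℕ) (m : ℕ) : X.Sublist (X ++ m :: Y) := List.sublist_append_left _ _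
theorem Pperm_sub_right (X Y : List ℕ) (m : ℕ) : Y.Sublist (X ++ m :: Y) :=
  (List.sublist_cons_self m Y).trans (List.sublist_append_right _ _)

theorem tail_sub {a m : ℕ} {s Y : List ℕ} (h : (a :: s).Sublist (m :: Y)) : s.Sublist Y := by
  simpa using h.tail

theorem S_lam {X Y : List ℕ} {m : ℕ} (hX : ∀ x ∈ X, x < m) (hY : ∀ x ∈ Y, x < m)
    (hXY : ∀ x ∈ X, ∀ y ∈ Y, x < y) (k : ℕ) :
    Has (Lam (k + 1)) (X ++ m :: Y) ↔ Has (Lam (k + 1)) X ∨ Has (Rho k) Y := by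
  constructor
  · rintro ⟨s, hs, h⟩
    obtain ⟨u, v, rfl, hu, hv⟩ := List.sublist_append_iff.1 hs
    obtain ⟨a, s', he, h1, h2⟩ := (lam_succ _ _).1 h
    rcases u with _ | ⟨b, u⟩
    · right
      simp at he
      subst he
      exact ⟨s', tail_sub hv, h1⟩
    · left
      simp at he
      obtain ⟨rfl, rfl⟩ := he
      rcases v with _ | ⟨c, v⟩
      · exact ⟨_, hu, by simpa using h⟩
      · exfalso
        have hb := hu.subset (List.mem_cons_self)
        have hc := hv.subset (List.mem_cons_self)
        have := h2 c (by simp)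
        rcases List.mem_cons.1 hc with rfl | hc
        · have := hX b hb; omega
        · have := hXY b hb c hc; omega
  · rintro (h | ⟨s, hs, h⟩)
    · exact has_mono (Pperm_sub_left _ _ _) h
    · exact ⟨m :: s, (hs.cons_cons m).trans (List.sublist_append_right _ _),
        (lam_succ _ _).2 ⟨m, s, rfl, h, fun x hx => hY x (hs.subset hx)⟩⟩

theorem sub_of_ne {m : ℕ} {v Y : List ℕ} (h : v.Sublist (m :: Y)) (hm : ∀ x ∈ v, x < m) :
    v.Sublist Y := by
  rcases List.sublist_cons_iff.1 h with h | ⟨r, rfl, -⟩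
  · exact h
  · exact absurd (hm m (by simp)) (lt_irrefl m)

theorem cons_last {m : ℕ} {v s Y : List ℕ} (hY : ∀ x ∈ Y, x < m)
    (h : (v ++ m :: s).Sublist (m :: Y)) : v = [] ∧ s.Sublist Y := by
  rcases List.sublist_cons_iff.1 h with h | ⟨r, hr, h⟩
  · exact absurd (hY m (h.subset (by simp))) (lt_irrefl m)
  · rcases v with _ | ⟨a, v⟩
    · simp at hr; subst hr; exact ⟨rfl, h⟩
    · simp at hr
      obtain ⟨rfl, rfl⟩ := hr
      exact absurd (hY a (h.subset (by simp))) (lt_irrefl a)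

theorem has_lam_zero (l : List ℕ) : Has (Lam 0) l := ⟨[], List.nil_sublist _, (lam_zero _).2 rfl⟩
theorem has_rho_zero (l : List ℕ) : Has (Rho 0) l := ⟨[], List.nil_sublist _, (rho_zero _).2 rfl⟩

theorem rho_back {X Y : List ℕ} {m : ℕ} (hX : ∀ x ∈ X, x < m) (k : ℕ)
    (h : Has (Lam k) X ∨ Has (Rho (k + 1)) Y) : Has (Rho (k + 1)) (X ++ m :: Y) := by
  rcases h with ⟨s, hs, h⟩ | h
  · refine ⟨s ++ [m], hs.append (List.singleton_sublist.2 (by simp)),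
      (rho_succ _ _).2 ⟨s, m, rfl, h, fun x hx => hX x (hs.subset hx)⟩⟩
  · exact has_mono (Pperm_sub_right _ _ _) h

theorem lam_back {X Y : List ℕ} {m : ℕ} (hY : ∀ x ∈ Y, x < m) (k : ℕ)
    (h : Has (Lam (k + 1)) X ∨ Has (Rho k) Y) : Has (Lam (k + 1)) (X ++ m :: Y) := by
  rcases h with h | ⟨s, hs, h⟩
  · exact has_mono (Pperm_sub_left _ _ _) h
  · exact ⟨m :: s, (hs.cons_cons m).trans (List.sublist_append_right _ _),
        (lam_succ _ _).2 ⟨m, s, rfl, h, fun x hx => hY x (hs.subset hx)⟩⟩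

theorem S_rho {X Y : List ℕ} {m : ℕ} (hX : ∀ x ∈ X, x < m) (hY : ∀ x ∈ Y, x < m)
    (hXY : ∀ x ∈ X, ∀ y ∈ Y, x < y) (k : ℕ) :
    Has (Rho (k + 1)) (X ++ m :: Y) ↔ Has (Lam k) X ∨ Has (Rho (k + 1)) Y := by
  refine ⟨?_, rho_back hX k⟩
  rintro ⟨s, hs, h⟩
  rcases k with _ | k
  · exact Or.inl (has_lam_zero X)
  obtain ⟨u, v, rfl, hu, hv⟩ := List.sublist_append_iff.1 hs
  obtain ⟨s', c, he, h1, h2⟩ := (rho_succ _ _).1 h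
  rcases List.eq_nil_or_concat v with rfl | ⟨v', c', rfl⟩
  · left
    simp at he; subst he
    exact ⟨s', (List.sublist_append_left _ _).trans hu, h1⟩
  simp only [List.concat_eq_append] at *
  rw [← List.append_assoc] at he
  obtain ⟨rfl, hc⟩ := List.append_inj' he rfl
  simp at hc; subst hc
  obtain ⟨a, s'', he', h1', h2'⟩ := (lam_succ _ _).1 h1
  have hc : c' ∈ m :: Y := hv.subset (by simp)
  have hac : a < c' := h2 a (by simp [he'])
  rcases u with _ | ⟨b, u⟩
  · right
    simp at he'
    subst he'
    rcases List.sublist_cons_iff.1 hv with hv | ⟨r, hr, hv⟩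
    · exact ⟨_, hv, by simpa using h⟩
    · exfalso
      simp at hr
      obtain ⟨rfl, rfl⟩ := hr
      have := hY c' (hv.subset (by simp)); omega
  · left
    simp at he'
    obtain ⟨rfl, rfl⟩ := he'
    rcases v' with _ | ⟨d, v'⟩
    · exact ⟨_, hu, by simpa using h1⟩
    · exfalso
      have hb := hu.subset (List.mem_cons_self)
      have hd : d ∈ m :: Y := hv.subset (by simp)
      have := h2' d (by simp)
      rcases List.mem_cons.1 hd with rfl | hc
      · have := hX b hb; omega
      · have := hXY b hb d hc; omega

theorem Q_lam {X Y : List ℕ} {m : ℕ} (hX : ∀ x ∈ X, x < m) (hY : ∀ x ∈ Y, x < m)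
    (hXY : ∀ x ∈ X, ∀ y ∈ Y, y < x) (k : ℕ) :
    Has (Lam (k + 1)) (X ++ m :: Y) ↔ Has (Lam (k + 1)) X ∨ Has (Rho k) Y := by
  refine ⟨?_, lam_back hY k⟩
  rintro ⟨s, hs, h⟩
  rcases k with _ | k
  · exact Or.inr (has_rho_zero Y)
  obtain ⟨u, v, rfl, hu, hv⟩ := List.sublist_append_iff.1 hs
  obtain ⟨a, s', he, h1, h2⟩ := (lam_succ _ _).1 h
  rcases u with _ | ⟨b, u⟩
  · right
    simp at he; subst he
    exact ⟨s', tail_sub hv, h1⟩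
  simp at he
  obtain ⟨rfl, rfl⟩ := he
  have hb := hu.subset (List.mem_cons_self)
  have hbm := hX b hb
  have hvY : v.Sublist Y := sub_of_ne hv fun x hx => (h2 x (by simp [hx])).trans hbm
  obtain ⟨w, c, he', h1', h2'⟩ := (rho_succ _ _).1 h1
  rcases List.eq_nil_or_concat v with rfl | ⟨v', c', rfl⟩
  · left
    exact ⟨_, hu, by simpa using h⟩
  right
  simp only [List.concat_eq_append] at *
  rw [← List.append_assoc] at he'
  obtain ⟨rfl, hc⟩ := List.append_inj' he' rfl
  simp at hc; subst hc
  rcases u with _ | ⟨d, u⟩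
  · exact ⟨_, hvY, by simpa using h1⟩
  · exfalso
    have := h2' d (by simp)
    have := hXY d (hu.subset (by simp)) c' (hvY.subset (by simp))
    omega

theorem Q_rho {X Y : List ℕ} {m : ℕ} (hX : ∀ x ∈ X, x < m) (hY : ∀ x ∈ Y, x < m)
    (hXY : ∀ x ∈ X, ∀ y ∈ Y, y < x) (k : ℕ) :
    Has (Rho (k + 1)) (X ++ m :: Y) ↔ Has (Lam k) X ∨ Has (Rho (k + 1)) Y := by
  refine ⟨?_, rho_back hX k⟩
  rintro ⟨s, hs, h⟩
  rcases k with _ | k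
  · exact Or.inl (has_lam_zero X)
  obtain ⟨u, v, rfl, hu, hv⟩ := List.sublist_append_iff.1 hs
  obtain ⟨s', c, he, h1, h2⟩ := (rho_succ _ _).1 h
  rcases List.eq_nil_or_concat v with rfl | ⟨v', c', rfl⟩
  · left
    simp at he; subst he
    exact ⟨s', (List.sublist_append_left _ _).trans hu, h1⟩
  simp only [List.concat_eq_append] at *
  rw [← List.append_assoc] at he
  obtain ⟨rfl, hc⟩ := List.append_inj' he rfl
  simp at hc; subst hc
  have hc : c' ∈ m :: Y := hv.subset (by simp)
  rcases u with _ | ⟨b, u⟩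
  · right
    obtain ⟨a, s'', he', h1', h2'⟩ := (lam_succ _ _).1 h1
    have hac : a < c' := h2 a (by simp [he'])
    simp at he'
    subst he'
    rcases List.sublist_cons_iff.1 hv with hv | ⟨r, hr, hv⟩
    · exact ⟨_, hv, by simpa using h⟩
    · exfalso
      simp at hr
      obtain ⟨rfl, rfl⟩ := hr
      have := hY c' (hv.subset (by simp)); omega
  · left
    have hb := hu.subset (List.mem_cons_self)
    have hbc := h2 b (by simp)
    have hcm : c' = m := by
      rcases List.mem_cons.1 hc with h | h
      · exact h
      · have := hXY b hb _ h; omega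
    subst hcm
    obtain ⟨rfl, -⟩ := cons_last hY hv
    exact ⟨_, hu, by simpa using h1⟩

def PiP (k j : ℕ) (s : List ℕ) : Prop :=
  ∃ s1 s2, s = s1 ++ s2 ∧ Lam k s1 ∧ Lam (j + 1) s2 ∧ ∀ x ∈ s1, ∀ y ∈ s2, x < y

def TauP (k j : ℕ) (s : List ℕ) : Prop :=
  ∃ s1 s2, s = s1 ++ s2 ∧ Rho (k + 1) s1 ∧ Rho j s2 ∧ ∀ x ∈ s1, ∀ y ∈ s2, y < x

theorem S_pi {X Y : List ℕ} {m : ℕ} (hX : ∀ x ∈ X, x < m) (hY : ∀ x ∈ Y, x < m)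
    (hXY : ∀ x ∈ X, ∀ y ∈ Y, x < y) (k j : ℕ) :
    Has (PiP k j) (X ++ m :: Y) ↔
      Has (PiP k j) X ∨ (Has (Lam k) X ∧ Has (Rho j) Y) ∨ Has (PiP k j) Y := by
  constructor
  · rintro ⟨s, hs, s1, s2, rfl, h1, h2, h3⟩
    have hXm : ∀ x ∈ X, ∀ y ∈ m :: Y, x < y := by
      intro x hx y hy
      rcases List.mem_cons.1 hy with rfl | hy
      · exact hX x hx
      · exact hXY x hx y hy
    obtain ⟨u, v, he, hu, hv⟩ := List.sublist_append_iff.1 hs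
    obtain ⟨a, s2', rfl, h4, h5⟩ := (lam_succ _ _).1 h2
    rcases List.append_eq_append_iff.1 he with ⟨w, rfl, hw⟩ | ⟨w, rfl, rfl⟩
    · rcases w with _ | ⟨b, w⟩
      · simp at hw hu; subst hw
        exact Or.inr (Or.inl ⟨⟨s1, hu, h1⟩, ⟨s2', tail_sub hv, h4⟩⟩)
      · simp at hw; obtain ⟨rfl, rfl⟩ := hw
        rcases v with _ | ⟨c, v⟩
        · left
          exact ⟨_, hu, s1, a :: w, rfl, h1, by simpa using h2, by simpa using h3⟩
        · exfalso
          have := hXm a (hu.subset (by simp)) c (hv.subset (by simp))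
          have := h5 c (by simp)
          omega
    · rcases k with _ | k
      · right; left
        refine ⟨has_lam_zero X, s2', tail_sub ((List.sublist_append_right _ _).trans hv), h4⟩
      obtain ⟨b, s', hs', h6, h7⟩ := (lam_succ _ _).1 h1
      rcases u with _ | ⟨b', u⟩
      · right; right
        simp at hs'; subst hs'
        rcases List.sublist_cons_iff.1 hv with hv | ⟨r, hr, hv⟩
        · exact ⟨_, hv, b :: s', a :: s2', rfl, by simpa using h1, h2, by simpa using h3⟩
        · exfalso
          simp at hr
          obtain ⟨rfl, rfl⟩ := hr
          have := h3 b (by simp) a (by simp)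
          have := hY a (hv.subset (by simp))
          omega
      · simp at hs'; obtain ⟨rfl, rfl⟩ := hs'
        rcases w with _ | ⟨c, w⟩
        · right; left
          exact ⟨⟨_, hu, by simpa using h1⟩, ⟨s2', tail_sub (by simpa using hv), h4⟩⟩
        · exfalso
          have := hXm b' (hu.subset (by simp)) c (hv.subset (by simp))
          have := h7 c (by simp)
          omega
  · rintro (h | ⟨⟨s, hs, h⟩, ⟨t, ht, h'⟩⟩ | h)
    · exact has_mono (Pperm_sub_left _ _ _) h
    · refine ⟨s ++ m :: t, hs.append (ht.cons_cons m), s, m :: t, rfl, h,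
        (lam_succ _ _).2 ⟨m, t, rfl, h', fun x hx => hY x (ht.subset hx)⟩, ?_⟩
      intro x hx y hy
      rcases List.mem_cons.1 hy with rfl | hy
      · exact hX x (hs.subset hx)
      · exact hXY x (hs.subset hx) y (ht.subset hy)
    · exact has_mono (Pperm_sub_right _ _ _) h

theorem Q_tau {X Y : List ℕ} {m : ℕ} (hX : ∀ x ∈ X, x < m) (hY : ∀ x ∈ Y, x < m)
    (hXY : ∀ x ∈ X, ∀ y ∈ Y, y < x) (k j : ℕ) :
    Has (TauP k j) (X ++ m :: Y) ↔
      Has (TauP k j) X ∨ (Has (Lam k) X ∧ Has (Rho j) Y) ∨ Has (TauP k j) Y := by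
  constructor
  · rintro ⟨s, hs, s1, s2, rfl, h1, h2, h3⟩
    rcases j with _ | j
    · rcases (Q_rho hX hY hXY k).1 ⟨s1, (List.sublist_append_left _ _).trans hs, h1⟩ with h | ⟨s, hs, h⟩
      · exact Or.inr (Or.inl ⟨h, has_rho_zero Y⟩)
      · right; right
        exact ⟨s, hs, s, [], by simp, h, (rho_zero _).2 rfl, by simp⟩
    obtain ⟨u, v, he, hu, hv⟩ := List.sublist_append_iff.1 hs
    obtain ⟨t, c, rfl, h4, h5⟩ := (rho_succ _ _).1 h1
    obtain ⟨z, d, rfl, h6, h7⟩ := (rho_succ _ _).1 h2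
    have key : (t ++ [c]).Sublist X → (z ++ [d]).Sublist (m :: Y) →
        Has (Lam k) X ∧ Has (Rho (j + 1)) Y := by
      intro ha hb
      refine ⟨⟨t, (List.sublist_append_left _ _).trans ha, h4⟩, ⟨_, sub_of_ne hb ?_, h2⟩⟩
      intro x hx
      exact (h3 c (by simp) x hx).trans (hX c (ha.subset (by simp)))
    rcases List.append_eq_append_iff.1 he with ⟨w, rfl, hw⟩ | ⟨w, hw, rfl⟩
    · rcases List.eq_nil_or_concat v with rfl | ⟨v', d', rfl⟩
      · left
        simp at hw; subst hw
        exact ⟨_, hu, _, _, rfl, h1, h2, h3⟩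
      · simp only [List.concat_eq_append] at *
        rw [← List.append_assoc] at hw
        obtain ⟨rfl, hd⟩ := List.append_inj' hw rfl
        simp at hd; subst hd
        rcases w with _ | ⟨b, w⟩
        · right; left
          exact key (by simpa using hu) (by simpa using hv)
        · exfalso
          have hc : c < m := hX c (hu.subset (by simp))
          have hdc := h3 c (by simp) d (by simp)
          have hd : d ∈ m :: Y := hv.subset (by simp)
          have := h7 b (by simp)
          rcases List.mem_cons.1 hd with rfl | hd
          · omega
          · have := hXY b (hu.subset (by simp)) d hd; omega
    · rcases List.eq_nil_or_concat w with rfl | ⟨w', c', rfl⟩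
      · right; left
        refine key ?_ (by simpa using hv)
        rw [hw]; simpa using hu
      simp only [List.concat_eq_append] at *
      rw [← List.append_assoc] at hw
      obtain ⟨rfl, hc⟩ := List.append_inj' hw rfl
      simp at hc; subst hc
      rcases u with _ | ⟨b, u⟩
      · rcases List.sublist_cons_iff.1 hv with hv | ⟨r, hr, hv⟩
        · right; right
          exact ⟨_, hv, w' ++ [c], _, rfl, by simpa using h1, h2, by simpa using h3⟩
        · right; left
          rcases w' with _ | ⟨b, w'⟩
          · simp at hr
            obtain ⟨rfl, rfl⟩ := hr
            exact ⟨⟨[], List.nil_sublist _, by simpa using h4⟩, ⟨_, hv, h2⟩⟩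
          · exfalso
            simp at hr
            obtain ⟨rfl, rfl⟩ := hr
            have := h5 b (by simp)
            have := hY c (hv.subset (by simp))
            omega
      · right; left
        have hcm : c = m := by
          have hc : c ∈ m :: Y := hv.subset (by simp)
          rcases List.mem_cons.1 hc with h | h
          · exact h
          · have := hXY b (hu.subset (by simp)) _ h
            have := h5 b (by simp)
            omega
        subst hcm
        rw [List.append_assoc] at hv
        obtain ⟨rfl, h8⟩ := cons_last hY hv
        exact ⟨⟨_, hu, by simpa using h4⟩, ⟨_, h8, h2⟩⟩
  · rintro (h | ⟨⟨s, hs, h⟩, ⟨t, ht, h'⟩⟩ | h)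
    · exact has_mono (Pperm_sub_left _ _ _) h
    · refine ⟨s ++ m :: t, hs.append (ht.cons_cons m), s ++ [m], t, by simp,
        (rho_succ _ _).2 ⟨s, m, rfl, h, fun x hx => hX x (hs.subset hx)⟩, h', ?_⟩
      intro x hx y hy
      rcases List.mem_append.1 hx with hx | hx
      · exact hXY x (hs.subset hx) y (ht.subset hy)
      · simp at hx; subst hx; exact hY y (ht.subset hy)
    · exact has_mono (Pperm_sub_right _ _ _) h

/-- Plane binary trees, encoding 231-avoiding (`S`) and 132-avoiding (`Q`) permutations. -/
inductive PT where
  | leaf : PT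
  | node : PT → PT → PT

def PT.size : PT → ℕ
  | .leaf => 0
  | .node A B => A.size + B.size + 1

def PT.S : PT → List ℕ
  | .leaf => []
  | .node A B => A.S ++ (A.size + B.size + 1) :: B.S.map (· + A.size)

def PT.Q : PT → List ℕ
  | .leaf => []
  | .node A B => A.Q.map (· + B.size) ++ (A.size + B.size + 1) :: B.Q

theorem PT.length_S (t : PT) : t.S.length = t.size := by
  induction t with
  | leaf => rfl
  | node A B hA hB => simp [PT.S, PT.size, hA, hB]; omega

theorem PT.length_Q (t : PT) : t.Q.length = t.size := by
  induction t with
  | leaf => rfl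
  | node A B hA hB => simp [PT.Q, PT.size, hA, hB]; omega

theorem range'_split (a b : ℕ) :
    List.range' 1 (a + b) = List.range' 1 a ++ (List.range' 1 b).map (· + a) := by
  rw [← List.range'_append_1 (s := 1) (m := a) (n := b)]
  congr 1
  have := List.map_add_range' (a := a) 1 b 1
  rw [Nat.add_comm 1 a, ← this]
  simp only [Nat.add_comm]

theorem perm_node (X Y : List ℕ) (a b : ℕ) (hX : X.Perm (List.range' 1 a))
    (hY : Y.Perm (List.range' 1 b)) :
    (X ++ (a + b + 1) :: Y.map (· + a)).Perm (List.range' 1 (a + b + 1)) := by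
  rw [range'_split (a + b) 1, range'_split a b]
  refine List.perm_middle.trans ?_
  refine List.Perm.trans ?_ (List.perm_append_comm)
  refine List.Perm.append (l₁ := [a + b + 1]) ?_ (hX.append (hY.map _))
  simp [Nat.add_comm]

theorem PT.perm_S (t : PT) : t.S.Perm (List.range' 1 t.size) := by
  induction t with
  | leaf => exact List.Perm.refl _
  | node A B hA hB => exact perm_node _ _ _ _ hA hB

theorem PT.perm_Q (t : PT) : t.Q.Perm (List.range' 1 t.size) := by
  induction t with
  | leaf => exact List.Perm.refl _
  | node A B hA hB =>
    refine List.Perm.trans ?_ ((perm_node _ _ _ _ hB hA).trans ?_)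
    · simp only [PT.Q]
      refine List.perm_middle.trans (List.Perm.trans ?_ List.perm_middle.symm)
      rw [Nat.add_comm A.size]
      exact List.Perm.cons _ List.perm_append_comm
    · simp [PT.size, Nat.add_comm B.size]

theorem bdd_of_perm {l : List ℕ} {n x : ℕ} (h : l.Perm (List.range' 1 n)) (hx : x ∈ l) :
    1 ≤ x ∧ x ≤ n := by
  have := h.subset hx
  simp at this
  omega

theorem PT.S_bd (t : PT) : ∀ x ∈ t.S, 1 ≤ x ∧ x ≤ t.size := fun _ hx => bdd_of_perm t.perm_S hx
theorem PT.Q_bd (t : PT) : ∀ x ∈ t.Q, 1 ≤ x ∧ x ≤ t.size := fun _ hx => bdd_of_perm t.perm_Q hx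

theorem S_props (A B : PT) : (∀ x ∈ A.S, x < A.size + B.size + 1) ∧
    (∀ x ∈ B.S.map (· + A.size), x < A.size + B.size + 1) ∧
    (∀ x ∈ A.S, ∀ y ∈ B.S.map (· + A.size), x < y) := by
  refine ⟨?_, ?_, ?_⟩
  · intro x hx; have := A.S_bd x hx; omega
  · intro x hx
    obtain ⟨z, hz, rfl⟩ := List.mem_map.1 hx
    have := B.S_bd z hz; omega
  · intro x hx y hy
    obtain ⟨z, hz, rfl⟩ := List.mem_map.1 hy
    have := B.S_bd z hz; have := A.S_bd x hx; omega

theorem Q_props (A B : PT) : (∀ x ∈ A.Q.map (· + B.size), x < A.size + B.size + 1) ∧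
    (∀ x ∈ B.Q, x < A.size + B.size + 1) ∧
    (∀ x ∈ A.Q.map (· + B.size), ∀ y ∈ B.Q, y < x) := by
  refine ⟨?_, ?_, ?_⟩
  · intro x hx
    obtain ⟨z, hz, rfl⟩ := List.mem_map.1 hx
    have := A.Q_bd z hz; omega
  · intro x hx; have := B.Q_bd x hx; omega
  · intro y hy x hx
    obtain ⟨z, hz, rfl⟩ := List.mem_map.1 hy
    have := A.Q_bd z hz; have := B.Q_bd x hx; omega

theorem has_lam_map (l : List ℕ) (m c : ℕ) : Has (Lam m) (l.map (· + c)) ↔ Has (Lam m) l :=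
  contains_map l (lamP m) c
theorem has_rho_map (l : List ℕ) (m c : ℕ) : Has (Rho m) (l.map (· + c)) ↔ Has (Rho m) l :=
  contains_map l (rhoP m) c

theorem lam_rho_equiv (t : PT) : ∀ m, (Has (Lam m) t.S ↔ Has (Lam m) t.Q) ∧
    (Has (Rho m) t.S ↔ Has (Rho m) t.Q) := by
  induction t with
  | leaf => intro m; exact ⟨Iff.rfl, Iff.rfl⟩
  | node A B hA hB =>
    obtain ⟨s1, s2, s3⟩ := S_props A B
    obtain ⟨q1, q2, q3⟩ := Q_props A B
    intro m
    rcases m with _ | m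
    · exact ⟨iff_of_true (has_lam_zero _) (has_lam_zero _),
        iff_of_true (has_rho_zero _) (has_rho_zero _)⟩
    · simp only [PT.S, PT.Q]
      rw [S_lam s1 s2 s3, S_rho s1 s2 s3, Q_lam q1 q2 q3, Q_rho q1 q2 q3]
      simp only [has_lam_map, has_rho_map]
      rw [(hA _).1, (hA _).1, (hB _).2, (hB _).2]
      exact ⟨Iff.rfl, Iff.rfl⟩

theorem contains_pi (k j : ℕ) (l : List ℕ) :
    Contains l (osum (lamP k) (ossum [1] (rhoP j))) ↔ Has (PiP k j) l := by
  refine exists_congr fun s => and_congr_right fun _ => ?_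
  rw [oi_osum (bdd_lr k).1 (bdd_ossum bdd_one (bdd_lr j).2)]
  exact Iff.rfl

theorem contains_tau (k j : ℕ) (l : List ℕ) :
    Contains l (ossum (osum (lamP k) [1]) (rhoP j)) ↔ Has (TauP k j) l := by
  refine exists_congr fun s => and_congr_right fun _ => ?_
  rw [oi_ossum (bdd_osum (bdd_lr k).1 bdd_one) (bdd_lr j).2]
  exact Iff.rfl

theorem pi_tau_equiv (k j : ℕ) (t : PT) : Has (PiP k j) t.S ↔ Has (TauP k j) t.Q := by
  induction t with
  | leaf =>
    constructor
    · rintro ⟨s, hs, s1, s2, rfl, h1, h2, -⟩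
      exfalso
      obtain ⟨a, s', rfl, -⟩ := (lam_succ _ _).1 h2
      simp [PT.S] at hs
    · rintro ⟨s, hs, s1, s2, rfl, h1, h2, -⟩
      exfalso
      obtain ⟨a, s', rfl, -⟩ := (rho_succ _ _).1 h1
      simp [PT.Q] at hs
  | node A B hA hB =>
    obtain ⟨s1, s2, s3⟩ := S_props A B
    obtain ⟨q1, q2, q3⟩ := Q_props A B
    simp only [PT.S, PT.Q]
    rw [S_pi s1 s2 s3, Q_tau q1 q2 q3]
    have e1 : Has (PiP k j) (B.S.map (· + A.size)) ↔ Has (PiP k j) B.S := by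
      rw [← contains_pi, ← contains_pi, contains_map]
    have e2 : Has (TauP k j) (A.Q.map (· + B.size)) ↔ Has (TauP k j) A.Q := by
      rw [← contains_tau, ← contains_tau, contains_map]
    rw [e1, e2, has_lam_map, has_rho_map, hA, hB, (lam_rho_equiv A k).1, (lam_rho_equiv B j).2]

theorem foldr_max_le (l : List ℕ) (m : ℕ) (h : ∀ x ∈ l, x ≤ m) : l.foldr max 0 ≤ m := by
  induction l with
  | nil => simp
  | cons a l ih =>
    simp only [List.foldr_cons]
    exact max_le (h a (by simp)) (ih fun x hx => h x (by simp [hx]))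

theorem le_foldr_max (l : List ℕ) (m : ℕ) (h : m ∈ l) : m ≤ l.foldr max 0 := by
  induction l with
  | nil => simp at h
  | cons a l ih =>
    simp only [List.foldr_cons]
    rcases List.mem_cons.1 h with rfl | h
    · exact le_max_left _ _
    · exact (ih h).trans (le_max_right _ _)

theorem PpermAux_step (f : ℕ) (X Y : List ℕ) (m : ℕ) (hX : ∀ x ∈ X, x < m) (hY : ∀ x ∈ Y, x < m) :
    PpermAux (f + 1) (X ++ m :: Y) =
      (PpermAux f X).map (· + Y.length) ++ [m] ++ PpermAux f (Y.map (· - X.length)) := by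
  have hm : (X ++ m :: Y).foldr max 0 = m := by
    apply le_antisymm
    · apply foldr_max_le
      intro x hx
      simp only [List.mem_append, List.mem_cons] at hx
      rcases hx with h | h | h
      · exact (hX x h).le
      · exact h.le
      · exact (hY x h).le
    · exact le_foldr_max _ _ (by simp)
  have ht : (X ++ m :: Y).takeWhile (· ≠ m) = X := by
    rw [List.takeWhile_append_of_pos]
    · simp
    · intro x hx; simp; exact (hX x hx).ne
  have hd : (X ++ m :: Y).dropWhile (· ≠ m) = m :: Y := by
    rw [List.dropWhile_append_of_pos]
    · simp
    · intro x hx; simp; exact (hX x hx).ne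
  have gen : ∀ l : List ℕ, l ≠ [] → PpermAux (f + 1) l =
      (PpermAux f (l.takeWhile (· ≠ l.foldr max 0))).map
        (· + ((l.dropWhile (· ≠ l.foldr max 0)).tail).length) ++ [l.foldr max 0] ++
      PpermAux f (((l.dropWhile (· ≠ l.foldr max 0)).tail).map
        (· - (l.takeWhile (· ≠ l.foldr max 0)).length)) := by
    intro l hl
    rcases l with _ | ⟨a, l⟩
    · exact absurd rfl hl
    · rfl
  rw [gen _ (by simp), hm, ht, hd]
  simp

theorem PpermAux_S (t : PT) : ∀ f, t.size ≤ f → PpermAux f t.S = t.Q := by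
  induction t with
  | leaf => intro f _; cases f <;> rfl
  | node A B hA hB =>
    intro f hf
    simp only [PT.size] at hf
    obtain ⟨f, rfl⟩ : ∃ g, f = g + 1 := ⟨f - 1, by omega⟩
    obtain ⟨s1, s2, s3⟩ := S_props A B
    simp only [PT.S, PT.Q]
    rw [PpermAux_step _ _ _ _ s1 s2, hA f (by omega)]
    have : (B.S.map (· + A.size)).map (· - A.S.length) = B.S := by
      rw [A.length_S, List.map_map]
      convert List.map_id _
      ext x; simp
    rw [this, hB f (by omega)]
    simp [B.length_S]

theorem Pperm_S (t : PT) : Pperm t.S = t.Q := PpermAux_S t _ (by rw [t.length_S])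

theorem Q_inj : ∀ t t' : PT, t.Q = t'.Q → t = t' := by
  intro t
  induction t with
  | leaf =>
    intro t' h
    cases t' with
    | leaf => rfl
    | node A B => simp [PT.Q] at h
  | node A B hA hB =>
    intro t' h
    cases t' with
    | leaf => simp [PT.Q] at h
    | node A' B' =>
      have hs : (PT.node A B).size = (PT.node A' B').size := by
        rw [← PT.length_Q, h, PT.length_Q]
      simp only [PT.size] at hs
      obtain ⟨q1, q2, q3⟩ := Q_props A B
      obtain ⟨r1, r2, r3⟩ := Q_props A' B'
      simp only [PT.Q] at h
      rw [← hs] at h r1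
      have hlen : (A.Q.map (· + B.size)) = A'.Q.map (· + B'.size) ∧ B.Q = B'.Q := by
        rcases List.append_eq_append_iff.1 h with ⟨w, hw, hw'⟩ | ⟨w, hw, hw'⟩
        · rcases w with _ | ⟨c, w⟩
          · simp at hw hw'; exact ⟨hw.symm, hw'⟩
          · exfalso
            simp at hw'
            have := r1 c (by rw [hw]; simp)
            omega
        · rcases w with _ | ⟨c, w⟩
          · simp at hw hw'; exact ⟨hw, hw'.symm⟩
          · exfalso
            simp at hw'
            have := q1 c (by rw [hw]; simp)
            omega
      have h2 := hB _ hlen.2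
      subst h2
      have h1 := hA A' (List.map_injective_iff.2 (fun x y hxy => by simpa using hxy) hlen.1)
      rw [h1]

theorem triple_sub (l : List ℕ) (R : ℕ → ℕ → ℕ → Prop) :
    (∃ i j k, i < j ∧ j < k ∧ k < l.length ∧ R (l.getD i 0) (l.getD j 0) (l.getD k 0)) ↔
    ∃ a b c, [a, b, c].Sublist l ∧ R a b c := by
  constructor
  · rintro ⟨i, j, k, h1, h2, h3, h⟩
    refine ⟨_, _, _, ?_, h⟩
    rw [List.sublist_iff_exists_fin_orderEmbedding_get_eq]
    refine ⟨OrderEmbedding.ofStrictMono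
      (![⟨i, by omega⟩, ⟨j, by omega⟩, ⟨k, h3⟩] : Fin 3 → Fin l.length) ?_, ?_⟩
    · intro x y hxy
      fin_cases x <;> fin_cases y <;> simp at hxy ⊢ <;> omega
    · intro x
      have h1' : i < l.length := by omega
      have h2' : j < l.length := by omega
      fin_cases x <;> simp [h1', h2', h3] <;> rfl
  · rintro ⟨a, b, c, hs, h⟩
    obtain ⟨f, hf⟩ := List.sublist_iff_exists_fin_orderEmbedding_get_eq.1 hs
    refine ⟨f ⟨0, by simp⟩, f ⟨1, by simp⟩, f ⟨2, by simp⟩, ?_, ?_, (f _).2, ?_⟩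
    · exact f.strictMono (by simp)
    · exact f.strictMono (by simp)
    · have a0 := hf ⟨0, by simp⟩
      have a1 := hf ⟨1, by simp⟩
      have a2 := hf ⟨2, by simp⟩
      simp only [List.get_eq_getElem] at a0 a1 a2
      rw [List.getD_eq_getElem _ _ (f _).2, List.getD_eq_getElem _ _ (f _).2,
        List.getD_eq_getElem _ _ (f _).2, ← a0, ← a1, ← a2]
      exact h

theorem av231_iff (l : List ℕ) : Avoids231 l ↔
    ∀ a b c, [a, b, c].Sublist l → ¬ (c < a ∧ a < b) := by
  unfold Avoids231
  rw [triple_sub l (fun a b c => c < a ∧ a < b)]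
  push Not
  rfl

theorem av132_iff (l : List ℕ) : Avoids132 l ↔
    ∀ a b c, [a, b, c].Sublist l → ¬ (a < c ∧ c < b) := by
  unfold Avoids132
  rw [triple_sub l (fun a b c => a < c ∧ c < b)]
  push Not
  rfl

theorem perm_split (α β : List ℕ) (h : (α ++ β).Perm (List.range' 1 (α.length + β.length)))
    (hlt : ∀ x ∈ α, ∀ y ∈ β, x < y) :
    α.Perm (List.range' 1 α.length) ∧
      ∃ β' : List ℕ, β = β'.map (· + α.length) ∧ β'.Perm (List.range' 1 β'.length) := by
  have pa := List.perm_insertionSort (· ≤ ·) α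
  have pb := List.perm_insertionSort (· ≤ ·) β
  have e : List.insertionSort (· ≤ ·) α ++ List.insertionSort (· ≤ ·) β =
      List.range' 1 (α.length + β.length) := by
    refine List.Perm.eq_of_pairwise' (r := (· ≤ ·)) ?_ (List.pairwise_le_range' 1)
      ((pa.append pb).trans h)
    rw [List.pairwise_append]
    refine ⟨List.pairwise_insertionSort _ _, List.pairwise_insertionSort _ _, ?_⟩
    intro x hx y hy
    exact (hlt x (pa.subset hx) y (pb.subset hy)).le
  rw [range'_split] at e
  obtain ⟨e1, e2⟩ := List.append_inj e (by simp)
  rw [e1] at pa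
  rw [e2] at pb
  refine ⟨pa.symm, β.map (· - α.length), ?_, ?_⟩
  · rw [List.map_map]
    symm
    conv_rhs => rw [← List.map_id β]
    apply List.map_congr_left
    intro x hx
    obtain ⟨z, -, rfl⟩ := List.mem_map.1 (pb.symm.subset hx)
    simp
  · have := (pb.map (· - α.length)).symm
    rw [List.map_map] at this
    rw [List.length_map]
    convert this
    symm
    convert List.map_id _
    ext x; simp

theorem av231_map (l : List ℕ) (c : ℕ) : Avoids231 (l.map (· + c)) ↔ Avoids231 l := by
  rw [av231_iff, av231_iff]
  constructor
  · intro h x y z hs hh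
    exact h _ _ _ (hs.map (· + c)) (by simpa using hh)
  · intro h x y z hs hh
    obtain ⟨s, hs', he⟩ := List.sublist_map_iff.1 hs
    match s, he with
    | [x', y', z'], he =>
      simp at he
      exact h _ _ _ hs' (by omega)

theorem av132_map (l : List ℕ) (c : ℕ) : Avoids132 (l.map (· + c)) ↔ Avoids132 l := by
  rw [av132_iff, av132_iff]
  constructor
  · intro h x y z hs hh
    exact h _ _ _ (hs.map (· + c)) (by simpa using hh)
  · intro h x y z hs hh
    obtain ⟨s, hs', he⟩ := List.sublist_map_iff.1 hs
    match s, he with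
    | [x', y', z'], he =>
      simp at he
      exact h _ _ _ hs' (by omega)

theorem av231_sub {l l' : List ℕ} (h : l.Sublist l') (h' : Avoids231 l') : Avoids231 l := by
  rw [av231_iff] at *
  exact fun a b c hs => h' a b c (hs.trans h)

theorem av132_sub {l l' : List ℕ} (h : l.Sublist l') (h' : Avoids132 l') : Avoids132 l := by
  rw [av132_iff] at *
  exact fun a b c hs => h' a b c (hs.trans h)

theorem av231_node {X Y : List ℕ} {m : ℕ} (hX : ∀ x ∈ X, x < m) (hY : ∀ x ∈ Y, x < m)
    (hXY : ∀ x ∈ X, ∀ y ∈ Y, x < y) (aX : Avoids231 X) (aY : Avoids231 Y) :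
    Avoids231 (X ++ m :: Y) := by
  rw [av231_iff] at *
  have hXm : ∀ x ∈ X, ∀ y ∈ m :: Y, x < y := by
    intro x hx y hy
    rcases List.mem_cons.1 hy with rfl | hy
    · exact hX x hx
    · exact hXY x hx y hy
  intro a b c hs hh
  obtain ⟨u, v, he, hu, hv⟩ := List.sublist_append_iff.1 hs
  match u, he with
  | [], he =>
    simp at he; subst he
    rcases List.sublist_cons_iff.1 hv with hv | ⟨r, hr, hv⟩
    · exact aY _ _ _ hv hh
    · simp at hr
      obtain ⟨rfl, rfl⟩ := hr
      have := hY b (hv.subset (by simp))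
      omega
  | [a'], he =>
    simp at he
    obtain ⟨rfl, rfl⟩ := he
    have := hXm a (hu.subset (by simp)) c (hv.subset (by simp))
    omega
  | [a', b'], he =>
    simp at he
    obtain ⟨rfl, rfl, rfl⟩ := he
    have := hXm a (hu.subset (by simp)) c (hv.subset (by simp))
    omega
  | a' :: b' :: c' :: u, he =>
    simp at he
    obtain ⟨rfl, rfl, rfl, rfl, rfl⟩ := he
    exact aX _ _ _ hu hh

theorem av132_node {X Y : List ℕ} {m : ℕ} (hX : ∀ x ∈ X, x < m) (hY : ∀ x ∈ Y, x < m)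
    (hXY : ∀ x ∈ X, ∀ y ∈ Y, y < x) (aX : Avoids132 X) (aY : Avoids132 Y) :
    Avoids132 (X ++ m :: Y) := by
  rw [av132_iff] at *
  intro a b c hs hh
  obtain ⟨u, v, he, hu, hv⟩ := List.sublist_append_iff.1 hs
  match u, he with
  | [], he =>
    simp at he; subst he
    rcases List.sublist_cons_iff.1 hv with hv | ⟨r, hr, hv⟩
    · exact aY _ _ _ hv hh
    · simp at hr
      obtain ⟨rfl, rfl⟩ := hr
      have := hY c (hv.subset (by simp))
      omega
  | [a'], he =>
    simp at he
    obtain ⟨rfl, rfl⟩ := he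
    have := hXY a (hu.subset (by simp)) c ((tail_sub hv).subset (by simp))
    omega
  | [a', b'], he =>
    simp at he
    obtain ⟨rfl, rfl, rfl⟩ := he
    have h1 := hX b (hu.subset (by simp))
    rcases List.mem_cons.1 (hv.subset (List.mem_cons_self)) with h | h
    · omega
    · have := hXY a (hu.subset (by simp)) c h
      omega
  | a' :: b' :: c' :: u, he =>
    simp at he
    obtain ⟨rfl, rfl, rfl, rfl, rfl⟩ := he
    exact aX _ _ _ hu hh

theorem PT.av_S (t : PT) : Avoids231 t.S := by
  induction t with
  | leaf => rw [av231_iff]; simp [PT.S]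
  | node A B hA hB =>
    obtain ⟨s1, s2, s3⟩ := S_props A B
    exact av231_node s1 s2 s3 hA ((av231_map _ _).2 hB)

theorem PT.av_Q (t : PT) : Avoids132 t.Q := by
  induction t with
  | leaf => rw [av132_iff]; simp [PT.Q]
  | node A B hA hB =>
    obtain ⟨s1, s2, s3⟩ := Q_props A B
    exact av132_node s1 s2 s3 ((av132_map _ _).2 hA) hB

theorem max_split {σ : List ℕ} {N : ℕ} (hN : σ.length = N + 1)
    (h : σ.Perm (List.range' 1 σ.length)) :
    ∃ α β, σ = α ++ (α.length + β.length + 1) :: β ∧ α.length + β.length = N ∧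
      (α ++ β).Perm (List.range' 1 (α.length + β.length)) ∧
      (∀ x ∈ α, ∀ y ∈ β, x ≠ y) := by
  rw [hN] at h
  have hmem : N + 1 ∈ σ := h.symm.subset (by simp)
  obtain ⟨α, β, rfl⟩ := List.append_of_mem hmem
  have hl : α.length + β.length = N := by simp at hN; omega
  refine ⟨α, β, by rw [hl], hl, ?_, ?_⟩
  · rw [hl]
    have h1 : ((N + 1) :: (α ++ β)).Perm ((N + 1) :: List.range' 1 N) := by
      refine List.perm_middle.symm.trans (h.trans ?_)
      rw [List.range'_concat]
      refine List.perm_append_comm.trans ?_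
      simp [Nat.add_comm]
    exact h1.cons_inv
  · have nd : (α ++ (N + 1) :: β).Nodup := h.nodup_iff.2 List.nodup_range'
    intro x hx y hy hxy
    subst hxy
    exact (List.disjoint_of_nodup_append nd) hx (List.mem_cons_of_mem _ hy)

theorem bdd_sum {α β : List ℕ} (h : (α ++ β).Perm (List.range' 1 (α.length + β.length))) :
    ∀ x, x ∈ α ∨ x ∈ β → x < α.length + β.length + 1 := by
  intro x hx
  have := bdd_of_perm h (List.mem_append.2 hx)
  omega

theorem S_surj : ∀ N (σ : List ℕ), σ.length = N → σ.Perm (List.range' 1 σ.length) → Avoids231 σ →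
    ∃ t : PT, t.S = σ := by
  intro N
  induction N using Nat.strong_induction_on with
  | _ N ih =>
    intro σ hN hp ha
    rcases N with _ | N
    · exact ⟨.leaf, (List.length_eq_zero_iff.1 hN).symm⟩
    obtain ⟨α, β, he, hl, hp', hne⟩ := max_split hN hp
    have hb := bdd_sum hp'
    have hlt : ∀ x ∈ α, ∀ y ∈ β, x < y := by
      intro x hx y hy
      by_contra hc
      refine (av231_iff _).1 ha x (α.length + β.length + 1) y ?_ ⟨?_, hb x (Or.inl hx)⟩
      · rw [he]
        exact (List.singleton_sublist.2 hx).append ((List.singleton_sublist.2 hy).cons_cons _)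
      · have := hne x hx y hy; omega
    obtain ⟨p1, β', hβ, p2⟩ := perm_split α β hp' hlt
    have hβl : β.length = β'.length := by rw [hβ]; simp
    obtain ⟨A, hA⟩ := ih α.length (by omega) α rfl p1
      (av231_sub (by rw [he]; exact List.sublist_append_left _ _) ha)
    obtain ⟨B, hB⟩ := ih β'.length (by omega) β' rfl p2 (by
      rw [← av231_map β' α.length, ← hβ]
      exact av231_sub (by rw [he]; exact Pperm_sub_right _ _ _) ha)
    refine ⟨.node A B, ?_⟩
    simp only [PT.S]
    rw [← A.length_S, ← B.length_S, hA, hB, he, hβl, ← hβ]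

theorem Q_surj : ∀ N (σ : List ℕ), σ.length = N → σ.Perm (List.range' 1 σ.length) → Avoids132 σ →
    ∃ t : PT, t.Q = σ := by
  intro N
  induction N using Nat.strong_induction_on with
  | _ N ih =>
    intro σ hN hp ha
    rcases N with _ | N
    · exact ⟨.leaf, (List.length_eq_zero_iff.1 hN).symm⟩
    obtain ⟨α, β, he, hl, hp', hne⟩ := max_split hN hp
    have hb := bdd_sum hp'
    have hlt : ∀ y ∈ β, ∀ x ∈ α, y < x := by
      intro y hy x hx
      by_contra hc
      refine (av132_iff _).1 ha x (α.length + β.length + 1) y ?_ ⟨?_, hb y (Or.inr hy)⟩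
      · rw [he]
        exact (List.singleton_sublist.2 hx).append ((List.singleton_sublist.2 hy).cons_cons _)
      · have := hne x hx y hy; omega
    obtain ⟨p1, α', hα, p2⟩ := perm_split β α (by
      rw [Nat.add_comm]; exact List.perm_append_comm.trans hp') hlt
    have hαl : α.length = α'.length := by rw [hα]; simp
    obtain ⟨B, hB⟩ := ih β.length (by omega) β rfl p1
      (av132_sub (by rw [he]; exact Pperm_sub_right _ _ _) ha)
    obtain ⟨A, hA⟩ := ih α'.length (by omega) α' rfl p2 (by
      rw [← av132_map α' β.length, ← hα]
      exact av132_sub (by rw [he]; exact List.sublist_append_left _ _) ha)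
    refine ⟨.node A B, ?_⟩
    simp only [PT.Q]
    rw [← A.length_Q, ← B.length_Q, hA, hB, he, hαl, ← hα]

/-- The trees of `λ_m` and `ρ_m`. -/
def lrT : ℕ → PT × PT
  | 0 => (.leaf, .leaf)
  | m + 1 => (.node .leaf (lrT m).2, .node (lrT m).1 .leaf)

theorem lrT_spec (m : ℕ) : (lrT m).1.S = lamP m ∧ (lrT m).1.Q = lamP m ∧
    (lrT m).2.S = rhoP m ∧ (lrT m).2.Q = rhoP m := by
  induction m with
  | zero => exact ⟨rfl, rfl, rfl, rfl⟩
  | succ m ih =>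
    obtain ⟨h1, h2, h3, h4⟩ := ih
    have e1 : lamP (m + 1) = ossum [1] (rhoP m) := rfl
    have e2 : rhoP (m + 1) = osum (lamP m) [1] := rfl
    have l1 : (lrT m).1.size = (lamP m).length := by rw [← h1, PT.length_S]
    have l2 : (lrT m).2.size = (rhoP m).length := by rw [← h3, PT.length_S]
    rw [e1, e2]
    refine ⟨?_, ?_, ?_, ?_⟩ <;>
      simp [lrT, PT.S, PT.Q, PT.size, ossum, osum, h1, h2, h3, h4, l1, l2, Nat.add_comm]

theorem pi_S (k j : ℕ) :
    (PT.node (lrT k).1 (lrT j).2).S = osum (lamP k) (ossum [1] (rhoP j)) := by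
  obtain ⟨h1, -, -, -⟩ := lrT_spec k
  obtain ⟨-, -, h3, -⟩ := lrT_spec j
  have l1 : (lrT k).1.size = (lamP k).length := by rw [← h1, PT.length_S]
  have l2 : (lrT j).2.size = (rhoP j).length := by rw [← h3, PT.length_S]
  simp only [PT.S, h1, h3, l1, l2, osum, ossum]
  simp
  omega

theorem pi_Q (k j : ℕ) :
    (PT.node (lrT k).1 (lrT j).2).Q = ossum (osum (lamP k) [1]) (rhoP j) := by
  obtain ⟨h1, h2, -, -⟩ := lrT_spec k
  obtain ⟨-, -, h3, h4⟩ := lrT_spec j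
  have l1 : (lrT k).1.size = (lamP k).length := by rw [← h1, PT.length_S]
  have l2 : (lrT j).2.size = (rhoP j).length := by rw [← h3, PT.length_S]
  simp only [PT.Q, h2, h4, l1, l2, osum, ossum]
  simp
  omega

theorem main_equiv (k j : ℕ) (t : PT) :
    Contains t.S (osum (lamP k) (ossum [1] (rhoP j))) ↔
      Contains t.Q (Pperm (osum (lamP k) (ossum [1] (rhoP j)))) := by
  rw [contains_pi, ← pi_S, Pperm_S, pi_Q, contains_tau, pi_tau_equiv]

/-- for `π = λ_k ⊕ (1 ⊖ ρ_{n-k-1})`, `P` restricts to a bijection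
between `Av(231, π)` and `Av(132, P(π))`: a 231-avoiding `σ` contains `π` iff
`P(σ)` contains `P(π)`. -/
theorem Pperm_wilf :
    ∀ n k : ℕ, k < n →
      (∀ σ : List ℕ, σ.Perm (List.range' 1 σ.length) → Avoids231 σ →
        (Contains σ (osum (lamP k) (ossum [1] (rhoP (n - k - 1)))) ↔
          Contains (Pperm σ)
            (Pperm (osum (lamP k) (ossum [1] (rhoP (n - k - 1))))))) ∧
      Set.BijOn Pperm
        {σ : List ℕ | σ.Perm (List.range' 1 σ.length) ∧ Avoids231 σ ∧
          ¬ Contains σ (osum (lamP k) (ossum [1] (rhoP (n - k - 1))))}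
        {σ : List ℕ | σ.Perm (List.range' 1 σ.length) ∧ Avoids132 σ ∧
          ¬ Contains σ
            (Pperm (osum (lamP k) (ossum [1] (rhoP (n - k - 1)))))} := by
  intro n k _
  generalize n - k - 1 = j
  refine ⟨?_, ?_, ?_, ?_⟩
  · intro σ hp ha
    obtain ⟨t, rfl⟩ := S_surj _ σ rfl hp ha
    rw [Pperm_S]
    exact main_equiv k j t
  · rintro σ ⟨hp, ha, hc⟩
    obtain ⟨t, rfl⟩ := S_surj _ σ rfl hp ha
    rw [Pperm_S]
    refine ⟨?_, t.av_Q, fun h => hc ((main_equiv k j t).2 h)⟩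
    rw [t.length_Q]
    exact t.perm_Q
  · rintro σ ⟨hp, ha, -⟩ σ' ⟨hp', ha', -⟩ h
    obtain ⟨t, rfl⟩ := S_surj _ σ rfl hp ha
    obtain ⟨t', rfl⟩ := S_surj _ σ' rfl hp' ha'
    rw [Pperm_S, Pperm_S] at h
    rw [Q_inj _ _ h]
  · rintro τ ⟨hp, ha, hc⟩
    obtain ⟨t, rfl⟩ := Q_surj _ τ rfl hp ha
    refine ⟨t.S, ⟨?_, t.av_S, fun h => hc ((main_equiv k j t).1 h)⟩, Pperm_S t⟩
    rw [t.length_S]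
    exact t.perm_S
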